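/- Let α be a real number with 0 ≤ 2α ≤ N − 7. Then for every u ∈ C_c^∞(ℍ^N∖{o}) one has ∫_{ℍ^N} (Δ_r u)²/r^α dv ≥ ((N+α)²(N−4−α)²/16) ∫_{ℍ^N} u²/r^{α+4} dv + ((N−1)(N−2−α)(N−2+α)/4) ∫_{ℍ^N} u²/r^{α+2} dv + ((N−1)²/4) ∫_{ℍ^N} u²/r^α dv. -/

import Mathlib

open MeasureTheory Real Set

noncomputable section

/-- The radial derivative `∇_r u = ∂u/∂r` of a function `u(r,σ)`. -/
def radGrad (N : ℕ) (u : ℝ → EuclideanSpace ℝ (Fin N) → ℝ) :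
    ℝ → EuclideanSpace ℝ (Fin N) → ℝ :=
  fun r σ => deriv (fun s => u s σ) r

/-- The radial Laplacian `Δ_r u = ∂²u/∂r² + (N-1) coth r · ∂u/∂r`. -/
def radLap (N : ℕ) (u : ℝ → EuclideanSpace ℝ (Fin N) → ℝ) :
    ℝ → EuclideanSpace ℝ (Fin N) → ℝ :=
  fun r σ => deriv (fun s => deriv (fun t => u t σ) s) r
    + ((N : ℝ) - 1) * (Real.cosh r / Real.sinh r) * deriv (fun s => u s σ) r

/-- The higher order radial derivative `∇_r^k u`: `Δ_r^{k/2} u` for even `k`,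
`∂_r (Δ_r^{(k-1)/2} u)` for odd `k`. -/
def radPow (N k : ℕ) (u : ℝ → EuclideanSpace ℝ (Fin N) → ℝ) :
    ℝ → EuclideanSpace ℝ (Fin N) → ℝ :=
  if Even k then (radLap N)^[k / 2] u else radGrad N ((radLap N)^[k / 2] u)

/-- The integral over the hyperbolic space `ℍ^N` in polar coordinates:
`∫_{S^{N-1}} ∫_0^∞ F(r,σ) (sinh r)^{N-1} dr dσ`, where `dσ` is the standard
surface measure (the `(N-1)`-dimensional Hausdorff measure) on the unit sphere. -/
def hypInt (N : ℕ) (F : ℝ → EuclideanSpace ℝ (Fin N) → ℝ) : ℝ :=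
  ∫ σ in Metric.sphere (0 : EuclideanSpace ℝ (Fin N)) 1,
    (∫ r in Ioi (0 : ℝ), F r σ * Real.sinh r ^ (N - 1)) ∂μH[(N : ℝ) - 1]

/-- `u ∈ C_c^∞(ℍ^N)`: `u(r,σ)` smooth (including at the pole `r = 0`) and
vanishing for all `r` larger than some `R`. -/
def IsCc (N : ℕ) (u : ℝ → EuclideanSpace ℝ (Fin N) → ℝ) : Prop :=
  ContDiff ℝ (⊤ : ℕ∞) (Function.uncurry u) ∧
  ∃ R : ℝ, ∀ r : ℝ, R < r → ∀ σ ∈ Metric.sphere (0 : EuclideanSpace ℝ (Fin N)) 1, u r σ = 0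

/-- `u ∈ C_c^∞(ℍ^N \ {o})`: `u(r,σ)` smooth with support contained in
`[a,b] × S^{N-1}` for some `0 < a ≤ b`. -/
def IsCcAway (N : ℕ) (u : ℝ → EuclideanSpace ℝ (Fin N) → ℝ) : Prop :=
  ContDiff ℝ (⊤ : ℕ∞) (Function.uncurry u) ∧
  ∃ a b : ℝ, 0 < a ∧ a ≤ b ∧
    ∀ r : ℝ, r ∉ Icc a b → ∀ σ ∈ Metric.sphere (0 : EuclideanSpace ℝ (Fin N)) 1, u r σ = 0

theorem nonneg_of_deriv_nonneg {f f' : ℝ → ℝ} (hf : ∀ x, HasDerivAt f (f' x) x) (h0 : f 0 = 0)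
    (hf' : ∀ x, 0 ≤ x → 0 ≤ f' x) {x : ℝ} (hx : 0 ≤ x) : 0 ≤ f x := by
  have hmono : MonotoneOn f (Ici 0) := by
    refine monotoneOn_of_deriv_nonneg (convex_Ici 0)
      (fun y _ => (hf y).continuousAt.continuousWithinAt)
      (fun y _ => (hf y).differentiableAt.differentiableWithinAt) fun y hy => ?_
    rw [interior_Ici] at hy
    rw [(hf y).deriv]
    exact hf' y hy.le
  simpa [h0] using hmono self_mem_Ici hx hx

theorem sinh_le_mul_cosh {x : ℝ} (hx : 0 ≤ x) : sinh x ≤ x * cosh x := by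
  have h := nonneg_of_deriv_nonneg (f := fun y => y * cosh y - sinh y) (f' := fun y => y * sinh y)
    (fun y => (((hasDerivAt_id' y).mul (hasDerivAt_cosh y)).sub (hasDerivAt_sinh y)).congr_deriv
      (by ring)) (by simp) (fun y hy => mul_nonneg hy (sinh_nonneg_iff.2 hy)) hx
  linarith

theorem three_mul_mul_cosh_le {x : ℝ} (hx : 0 ≤ x) : 3 * (x * cosh x) ≤ (3 + x ^ 2) * sinh x := by
  have h := nonneg_of_deriv_nonneg (f := fun y => (3 + y ^ 2) * sinh y - 3 * (y * cosh y))
    (f' := fun y => y * (y * cosh y - sinh y))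
    (fun y => (((((hasDerivAt_id' y).pow 2).const_add 3).mul (hasDerivAt_sinh y)).sub
      (((hasDerivAt_id' y).mul (hasDerivAt_cosh y)).const_mul 3)).congr_deriv
      (by simp; ring)) (by simp)
    (fun y hy => mul_nonneg hy (sub_nonneg.2 (sinh_le_mul_cosh hy))) hx
  linarith

theorem sinh_sq_mul_le {x : ℝ} (hx : 0 ≤ x) : sinh x ^ 2 * (3 - x ^ 2) ≤ 3 * x ^ 2 := by
  have hC (y : ℝ) : HasDerivAt (fun z => cosh (2 * z)) (sinh (2 * y) * 2) y :=
    ((hasDerivAt_id' y).const_mul 2).cosh.congr_deriv (by ring)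
  have hS (y : ℝ) : HasDerivAt (fun z => sinh (2 * z)) (cosh (2 * y) * 2) y :=
    ((hasDerivAt_id' y).const_mul 2).sinh.congr_deriv (by ring)
  have h2 (y : ℝ) (hy : 0 ≤ y) :
      0 ≤ 5 - 5 * cosh (2 * y) + 4 * (y * sinh (2 * y)) + 2 * (y ^ 2 * cosh (2 * y)) := by
    refine nonneg_of_deriv_nonneg
      (f := fun y => 5 - 5 * cosh (2 * y) + 4 * (y * sinh (2 * y)) + 2 * (y ^ 2 * cosh (2 * y)))
      (f' := fun y => 6 * (2 * y * cosh (2 * y) - sinh (2 * y)) + 4 * (y ^ 2 * sinh (2 * y)))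
      (fun y => (((((hC y).const_mul 5).const_sub 5).add
        (((hasDerivAt_id' y).mul (hS y)).const_mul 4)).add
        ((((hasDerivAt_id' y).pow 2).mul (hC y)).const_mul 2)).congr_deriv (by simp; ring))
      (by simp) (fun z hz => ?_) hy
    have := sinh_le_mul_cosh (x := 2 * z) (by linarith)
    have := mul_nonneg (sq_nonneg z) (sinh_nonneg_iff.2 (by linarith : 0 ≤ 2 * z))
    linarith
  have h1 (y : ℝ) (hy : 0 ≤ y) :
      0 ≤ 6 * y + y * (cosh (2 * y) - 1) - (3 - y ^ 2) * sinh (2 * y) := by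
    refine nonneg_of_deriv_nonneg
      (f := fun y => 6 * y + y * (cosh (2 * y) - 1) - (3 - y ^ 2) * sinh (2 * y)) (fun y =>
        (((((hasDerivAt_id' y).const_mul 6).add ((hasDerivAt_id' y).mul ((hC y).sub_const 1))).sub
        ((((hasDerivAt_id' y).pow 2).const_sub 3).mul (hS y))).congr_deriv (by simp; ring)))
      (by simp) h2 hy
  have h0 := nonneg_of_deriv_nonneg
    (f := fun y => 3 * y ^ 2 - (3 - y ^ 2) * (cosh (2 * y) - 1) / 2) (fun y =>
      ((((hasDerivAt_id' y).pow 2).const_mul 3).sub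
      (((((hasDerivAt_id' y).pow 2).const_sub 3).mul ((hC y).sub_const 1)).div_const 2)).congr_deriv
      (by simp; ring)) (by simp) h1 hx
  have hd : cosh (2 * x) - 1 = 2 * sinh x ^ 2 := by rw [cosh_two_mul, cosh_sq]; ring
  rw [hd] at h0
  linarith

theorem coth_mul_inv_le {r : ℝ} (hr : 0 < r) :
    cosh r / sinh r * r⁻¹ ≤ r⁻¹ ^ 2 + 1 / 3 := by
  have hs := sinh_pos_iff.2 hr
  have h := three_mul_mul_cosh_le hr.le
  have : r⁻¹ ^ 2 + 1 / 3 - cosh r / sinh r * r⁻¹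
      = ((3 + r ^ 2) * sinh r - 3 * (r * cosh r)) / (3 * r ^ 2 * sinh r) := by
    field_simp
  have h2 := div_nonneg (sub_nonneg.2 h) (by positivity : 0 ≤ 3 * r ^ 2 * sinh r)
  linarith

theorem inv_sq_le_coth_mul_inv {r : ℝ} (hr : 0 < r) :
    r⁻¹ ^ 2 ≤ cosh r / sinh r * r⁻¹ := by
  have hs := sinh_pos_iff.2 hr
  have h := sinh_le_mul_cosh hr.le
  have : cosh r / sinh r * r⁻¹ - r⁻¹ ^ 2 = (r * cosh r - sinh r) / (r ^ 2 * sinh r) := by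
    field_simp
  have h2 := div_nonneg (sub_nonneg.2 h) (by positivity : 0 ≤ r ^ 2 * sinh r)
  linarith

theorem inv_sq_add_le_coth_sq {r : ℝ} (hr : 0 < r) :
    r⁻¹ ^ 2 + 2 / 3 ≤ (cosh r / sinh r) ^ 2 := by
  have hs := sinh_pos_iff.2 hr
  have h := sinh_sq_mul_le hr.le
  have : (cosh r / sinh r) ^ 2 - (r⁻¹ ^ 2 + 2 / 3)
      = (3 * r ^ 2 - sinh r ^ 2 * (3 - r ^ 2)) / (3 * r ^ 2 * sinh r ^ 2) := by
    rw [div_pow, cosh_sq]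
    field_simp
    ring
  have h2 := div_nonneg (sub_nonneg.2 h) (by positivity : 0 ≤ 3 * r ^ 2 * sinh r ^ 2)
  linarith

theorem hasDerivAt_coth {r : ℝ} (hr : 0 < r) :
    HasDerivAt (fun s => cosh s / sinh s) (1 - (cosh r / sinh r) ^ 2) r := by
  have hs := (sinh_pos_iff.2 hr).ne'
  refine ((hasDerivAt_cosh r).div (hasDerivAt_sinh r) hs).congr_deriv ?_
  field_simp

theorem hasDerivAt_sinh_pow_div_rpow (n : ℕ) (β : ℝ) {r : ℝ} (hr : 0 < r) :
    HasDerivAt (fun s => sinh s ^ n / s ^ β)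
      ((n * (cosh r / sinh r) - β * r⁻¹) * (sinh r ^ n / r ^ β)) r := by
  have hs := (sinh_pos_iff.2 hr).ne'
  have hrp := (rpow_pos_of_pos hr β).ne'
  refine (((hasDerivAt_sinh r).pow n).div (hasDerivAt_rpow_const (p := β) (Or.inl hr.ne'))
    hrp).congr_deriv ?_
  rw [rpow_sub_one hr.ne']
  rcases n with _ | n
  · simp
    field_simp
  · simp only [Nat.add_sub_cancel, Pi.pow_apply]
    field_simp
    ring

/-- Weighted Hardy inequality for the first order operator `v ↦ v' + κ coth(r) v`. -/
theorem weighted_hardy (n : ℕ) (κ β K₁ K₂ : ℝ) {a b : ℝ} (ha : 0 < a) (hab : a ≤ b)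
    {v v' : ℝ → ℝ} (hv : ∀ x, HasDerivAt v (v' x) x) (hv' : Continuous v')
    (hva : v a = 0) (hvb : v b = 0)
    (hK : ∀ r, 0 < r → K₁ * r⁻¹ ^ 2 + K₂ ≤
      (κ * (cosh r / sinh r)) ^ 2 - ((β + 1) / 2 * r⁻¹ - n / 2 * (cosh r / sinh r)) ^ 2
      + ((β + 1) / 2 * r⁻¹ ^ 2 + (κ - n / 2) * ((cosh r / sinh r) ^ 2 - 1))
      + ((β + 1) / 2 * r⁻¹ + (κ - n / 2) * (cosh r / sinh r))
        * (β * r⁻¹ - n * (cosh r / sinh r))) :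
    K₁ * (∫ r in a..b, v r ^ 2 / r ^ (β + 2) * sinh r ^ n)
      + K₂ * (∫ r in a..b, v r ^ 2 / r ^ β * sinh r ^ n)
      ≤ ∫ r in a..b, (v' r + κ * (cosh r / sinh r) * v r) ^ 2 / r ^ β * sinh r ^ n := by
  set c : ℝ → ℝ := fun r => cosh r / sinh r with hc
  set p : ℝ → ℝ := fun r => sinh r ^ n / r ^ β with hp
  have hpos : ∀ r ∈ uIcc a b, 0 < r := fun r hr => ha.trans_le (uIcc_of_le hab ▸ hr).1
  have hcc : ContinuousOn c (uIcc a b) := fun r hr =>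
    (hasDerivAt_coth (hpos r hr)).continuousAt.continuousWithinAt
  have hpc : ContinuousOn p (uIcc a b) := fun r hr =>
    (hasDerivAt_sinh_pow_div_rpow n β (hpos r hr)).continuousAt.continuousWithinAt
  have hic : ContinuousOn (fun r : ℝ => r⁻¹) (uIcc a b) :=
    continuousOn_id.inv₀ fun r hr => (hpos r hr).ne'
  have hvc : ContinuousOn v (uIcc a b) := fun r _ => (hv r).continuousAt.continuousWithinAt
  have hvc' : ContinuousOn v' (uIcc a b) := hv'.continuousOn
  set G' : ℝ → ℝ := fun r =>
    (2 * v r * v' r * ((β + 1) / 2 * r⁻¹ + (κ - n / 2) * c r)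
      + v r ^ 2 * (-((β + 1) / 2 * r⁻¹ ^ 2) + (κ - n / 2) * (1 - c r ^ 2))
      + v r ^ 2 * ((β + 1) / 2 * r⁻¹ + (κ - n / 2) * c r) * (n * c r - β * r⁻¹)) * p r with hG'
  have hGd : ∀ r ∈ uIcc a b,
      HasDerivAt (fun r => v r ^ 2 * ((β + 1) / 2 * r⁻¹ + (κ - n / 2) * c r) * p r) (G' r) r := by
    intro r hr
    refine ((((hv r).pow 2).mul (((hasDerivAt_inv (hpos r hr).ne').const_mul _).add
      ((hasDerivAt_coth (hpos r hr)).const_mul _))).mul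
      (hasDerivAt_sinh_pow_div_rpow n β (hpos r hr))).congr_deriv ?_
    simp only [hG', hc, hp, Nat.cast_ofNat, Pi.add_apply, Pi.mul_apply, Pi.pow_apply, inv_pow]
    ring
  have hGi : IntervalIntegrable G' volume a b := ContinuousOn.intervalIntegrable (by fun_prop)
  have hG0 : ∫ r in a..b, G' r = 0 := by
    rw [intervalIntegral.integral_eq_sub_of_hasDerivAt hGd hGi]
    simp [hva, hvb]
  have e1 : ∫ r in a..b, v r ^ 2 / r ^ (β + 2) * sinh r ^ n
      = ∫ r in a..b, v r ^ 2 * r⁻¹ ^ 2 * p r := by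
    refine intervalIntegral.integral_congr fun r hr => ?_
    have h0 := hpos r hr
    simp only [hp, rpow_add h0, rpow_two]
    field_simp
  have e2 : ∫ r in a..b, v r ^ 2 / r ^ β * sinh r ^ n = ∫ r in a..b, v r ^ 2 * p r :=
    intervalIntegral.integral_congr fun r _ => by simp only [hp]; ring
  have e3 : ∫ r in a..b, (v' r + κ * c r * v r) ^ 2 / r ^ β * sinh r ^ n
      = ∫ r in a..b, (v' r + κ * c r * v r) ^ 2 * p r :=
    intervalIntegral.integral_congr fun r _ => by simp only [hp]; ring
  have i1 : IntervalIntegrable (fun r => v r ^ 2 * r⁻¹ ^ 2 * p r) volume a b :=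
    ContinuousOn.intervalIntegrable (by fun_prop)
  have i2 : IntervalIntegrable (fun r => v r ^ 2 * p r) volume a b :=
    ContinuousOn.intervalIntegrable (by fun_prop)
  have i3 : IntervalIntegrable (fun r => (v' r + κ * c r * v r) ^ 2 * p r) volume a b :=
    ContinuousOn.intervalIntegrable (by fun_prop)
  rw [e1, e2, e3, ← add_zero (_ + _), ← hG0, ← intervalIntegral.integral_const_mul,
    ← intervalIntegral.integral_const_mul,
    ← intervalIntegral.integral_add (i1.const_mul _) (i2.const_mul _),
    ← intervalIntegral.integral_add ((i1.const_mul _).add (i2.const_mul _)) hGi]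
  refine intervalIntegral.integral_mono_on hab (((i1.const_mul _).add (i2.const_mul _)).add hGi)
    i3 fun r hr => ?_
  have h0 := hpos r (uIcc_of_le hab ▸ hr)
  have hp0 : 0 ≤ p r := div_nonneg (pow_nonneg (sinh_nonneg_iff.2 h0.le) n) (rpow_nonneg h0.le β)
  have hk := mul_nonneg (sq_nonneg (v r)) (sub_nonneg.2 (hK r h0))
  have hsq := sq_nonneg (v' r - ((β + 1) / 2 * r⁻¹ - n / 2 * c r) * v r)
  have := mul_nonneg (add_nonneg hk hsq) hp0
  rw [← sub_nonneg]
  refine this.trans_eq ?_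
  simp only [hG', hc]
  ring

theorem hyperbolic_hardy {n : ℕ} (hn : 2 ≤ n) {β : ℝ} (hβ : 0 ≤ β) {a b : ℝ} (ha : 0 < a)
    (hab : a ≤ b) {v v' : ℝ → ℝ} (hv : ∀ x, HasDerivAt v (v' x) x) (hv' : Continuous v')
    (hva : v a = 0) (hvb : v b = 0) :
    (n - β - 1) ^ 2 / 4 * (∫ r in a..b, v r ^ 2 / r ^ (β + 2) * sinh r ^ n)
      + n * (n + 1 - β) / 6 * (∫ r in a..b, v r ^ 2 / r ^ β * sinh r ^ n)
      ≤ ∫ r in a..b, v' r ^ 2 / r ^ β * sinh r ^ n := by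
  have h := weighted_hardy n 0 β ((n - β - 1) ^ 2 / 4) (n * (n + 1 - β) / 6) ha hab hv hv' hva hvb
    fun r hr => ?_
  · simpa using h
  have hn' : (2 : ℝ) ≤ n := by exact_mod_cast hn
  have h1 := mul_le_mul_of_nonneg_left (coth_mul_inv_le hr) (by positivity : 0 ≤ β * n / 2)
  have h2 := mul_le_mul_of_nonneg_left (inv_sq_add_le_coth_sq hr)
    (div_nonneg (mul_nonneg (by linarith) (by linarith)) (by norm_num) :
      0 ≤ (n : ℝ) * (n - 2) / 4)
  linarith

theorem hyperbolic_hardy_divergence (n : ℕ) {β : ℝ} (hβ : 0 ≤ β) {a b : ℝ} (ha : 0 < a)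
    (hab : a ≤ b) {v v' : ℝ → ℝ} (hv : ∀ x, HasDerivAt v (v' x) x) (hv' : Continuous v')
    (hva : v a = 0) (hvb : v b = 0) :
    (n + 1 + β) ^ 2 / 4 * (∫ r in a..b, v r ^ 2 / r ^ (β + 2) * sinh r ^ n)
      + n * (n - 1) / 6 * (∫ r in a..b, v r ^ 2 / r ^ β * sinh r ^ n)
      ≤ ∫ r in a..b, (v' r + n * (cosh r / sinh r) * v r) ^ 2 / r ^ β * sinh r ^ n := by
  refine weighted_hardy n n β _ _ ha hab hv hv' hva hvb fun r hr => ?_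
  have h1 := mul_le_mul_of_nonneg_left (inv_sq_le_coth_mul_inv hr) (by positivity : 0 ≤ β * n / 2)
  have h2 := mul_le_mul_of_nonneg_left (inv_sq_add_le_coth_sq hr)
    (by positivity : 0 ≤ (n : ℝ) * (n + 2) / 4)
  linarith

theorem rellich_interval {n : ℕ} {α : ℝ} (hα0 : 0 ≤ α) (hα : 2 * α + 6 ≤ n) {a b : ℝ} (ha : 0 < a)
    (hab : a ≤ b) {u u' u'' : ℝ → ℝ} (hu : ∀ x, HasDerivAt u (u' x) x)
    (hu' : ∀ x, HasDerivAt u' (u'' x) x) (hu'' : Continuous u'')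
    (hua : u a = 0) (hub : u b = 0) (hua' : u' a = 0) (hub' : u' b = 0) :
    (n + 1 + α) ^ 2 * (n - 3 - α) ^ 2 / 16 * (∫ r in a..b, u r ^ 2 / r ^ (α + 4) * sinh r ^ n)
      + n * (n - 1 - α) * (n - 1 + α) / 4 * (∫ r in a..b, u r ^ 2 / r ^ (α + 2) * sinh r ^ n)
      + n ^ 2 / 4 * (∫ r in a..b, u r ^ 2 / r ^ α * sinh r ^ n)
      ≤ ∫ r in a..b, (u'' r + n * (cosh r / sinh r) * u' r) ^ 2 / r ^ α * sinh r ^ n := by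
  have hn : 2 ≤ n := by
    have : (2 : ℝ) ≤ n := by linarith
    exact_mod_cast this
  have hc' : Continuous u' := continuous_iff_continuousAt.2 fun x => (hu' x).continuousAt
  have h0 := hyperbolic_hardy_divergence n hα0 ha hab hu' hu'' hua' hub'
  have h1 := hyperbolic_hardy hn (by linarith : 0 ≤ α + 2) ha hab hu hc' hua hub
  have h2 := hyperbolic_hardy hn hα0 ha hab hu hc' hua hub
  rw [show α + 2 + 2 = α + 4 by ring] at h1
  have hpos (β : ℝ) : 0 ≤ ∫ r in a..b, u r ^ 2 / r ^ β * sinh r ^ n :=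
    intervalIntegral.integral_nonneg hab fun r hr =>
      have h : 0 ≤ r := ha.le.trans hr.1
      mul_nonneg (div_nonneg (sq_nonneg _) (rpow_nonneg h _)) (pow_nonneg (sinh_nonneg_iff.2 h) n)
  have p0 := hpos α
  have p2 := hpos (α + 2)
  generalize (∫ r in a..b, u r ^ 2 / r ^ α * sinh r ^ n) = I₀ at *
  generalize (∫ r in a..b, u r ^ 2 / r ^ (α + 2) * sinh r ^ n) = I₂ at *
  generalize (∫ r in a..b, u r ^ 2 / r ^ (α + 4) * sinh r ^ n) = I₄ at *
  generalize (n : ℝ) = m at *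
  have k1 := mul_le_mul_of_nonneg_left h1 (by positivity : 0 ≤ (m + 1 + α) ^ 2 / 4)
  have k2 := mul_le_mul_of_nonneg_left h2
    (div_nonneg (mul_nonneg (by linarith) (by linarith)) (by norm_num) : 0 ≤ m * (m - 1) / 6)
  have c0 : m ^ 2 / 4 ≤ m * (m - 1) / 6 * (m * (m + 1 - α) / 6) := by
    nlinarith [mul_nonneg (sq_nonneg m) (by nlinarith : 0 ≤ (m - 1) * (m + 1 - α) - 9)]
  have c2 : m * (m - 1 - α) * (m - 1 + α) / 4 ≤
      (m + 1 + α) ^ 2 / 4 * (m * (m + 1 - (α + 2)) / 6)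
        + m * (m - 1) / 6 * ((m - α - 1) ^ 2 / 4) := by
    have hA : 0 ≤ m * (m - 1 - α) := mul_nonneg (by linarith) (by linarith)
    have hB : 0 ≤ (m + 1 + α) ^ 2 + (m - 1) * (m - 1 - α) - 6 * (m - 1 + α) := by nlinarith
    nlinarith [mul_nonneg hA hB]
  have d0 := mul_le_mul_of_nonneg_right c0 p0
  have d2 := mul_le_mul_of_nonneg_right c2 p2
  linarith

theorem hausdorffMeasure_sphere_lt_top {E : Type*} [NormedAddCommGroup E] [InnerProductSpace ℝ E]
    [MeasurableSpace E] [BorelSpace E] {n : ℕ} [Fact (Module.finrank ℝ E = n + 1)] :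
    μH[(n : ℝ)] (Metric.sphere (0 : E) 1) < ⊤ := by
  have : FiniteDimensional ℝ E := .of_fact_finrank_eq_succ n
  refine (isCompact_sphere (0 : E) 1).measure_lt_top_of_nhdsWithin fun x hx => ?_
  have hx1 : ‖-x‖ = 1 := by simpa using hx
  have hfr : Module.finrank ℝ (ℝ ∙ (-x))ᗮ = n :=
    Submodule.finrank_orthogonal_span_singleton (by rintro h; simp [h] at hx1)
  let f : (ℝ ∙ (-x))ᗮ → E := fun w => (stereoInvFun hx1 w : E)
  have hf : ContDiff ℝ 1 f := by
    have : f = stereoInvFunAux (-x) ∘ (↑) := rfl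
    rw [this]
    exact contDiff_stereoInvFunAux.comp (ℝ ∙ (-x))ᗮ.subtypeL.contDiff
  let e := stereographic hx1
  have hne : (⟨x, hx⟩ : Metric.sphere (0 : E) 1) ∈ e.source := by
    rw [stereographic_source]
    intro h
    have h2 : x + x = 0 := eq_neg_iff_add_eq_zero.1 (congrArg Subtype.val h)
    rw [← two_smul ℝ, smul_eq_zero_iff_right two_ne_zero] at h2
    simp [h2] at hx1
  obtain ⟨K, t, ht, hL⟩ := hf.locallyLipschitz (e ⟨x, hx⟩)
  obtain ⟨ε, hε, hsub⟩ := Metric.nhds_basis_closedBall.mem_iff.1 ht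
  have hnhds : f '' Metric.closedBall (e ⟨x, hx⟩) ε ∈ nhdsWithin x (Metric.sphere (0 : E) 1) := by
    have h1 : e ⁻¹' Metric.closedBall (e ⟨x, hx⟩) ε ∩ e.source ∈
        nhds (⟨x, hx⟩ : Metric.sphere (0 : E) 1) := by
      exact Filter.inter_mem ((e.continuousAt hne).preimage_mem_nhds
        (Metric.closedBall_mem_nhds _ hε)) (e.open_source.mem_nhds hne)
    rw [nhdsWithin_eq_map_subtype_coe hx, Filter.mem_map]
    filter_upwards [h1] with y hy
    exact ⟨e y, hy.1, congrArg Subtype.val (e.left_inv hy.2)⟩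
  refine ⟨_, hnhds, ?_⟩
  have h2 := (hL.mono hsub).hausdorffMeasure_image_le (d := n) (by positivity)
  refine h2.trans_lt (ENNReal.mul_lt_top (by simp) ?_)
  have h3 : (μH[((Module.finrank ℝ (ℝ ∙ (-x))ᗮ : ℕ) : ℝ)] : Measure (ℝ ∙ (-x))ᗮ)
      (Metric.closedBall (e ⟨x, hx⟩) ε) < ⊤ := (isCompact_closedBall _ ε).measure_lt_top
  rwa [hfr] at h3

theorem continuous_intervalIntegral_of_continuousOn_Ioi {E : Type*} [TopologicalSpace E]
    [FirstCountableTopology E] {F : ℝ → E → ℝ}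
    (hF : ContinuousOn (Function.uncurry F) (Ioi 0 ×ˢ univ)) {a b : ℝ} (ha : 0 < a) (hab : a ≤ b) :
    Continuous fun σ => ∫ r in a..b, F r σ := by
  have h : Continuous (Function.uncurry fun (σ : E) (r : ℝ) => F (max r a) σ) := by
    have : Continuous fun q : E × ℝ => ((max q.2 a, q.1) : ℝ × E) := by fun_prop
    exact hF.comp_continuous this fun q => ⟨ha.trans_le (le_max_right _ _), mem_univ _⟩
  refine (intervalIntegral.continuous_parametric_intervalIntegral_of_continuous' h a b).congr
    fun σ => intervalIntegral.integral_congr fun r hr => ?_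
  rw [uIcc_of_le hab] at hr
  simp only [max_eq_left hr.1]

theorem contDiff_uncurry_deriv {E : Type*} [NormedAddCommGroup E] [NormedSpace ℝ E]
    {u : ℝ → E → ℝ} (hu : ContDiff ℝ (⊤ : ℕ∞) (Function.uncurry u)) :
    ContDiff ℝ (⊤ : ℕ∞) (Function.uncurry fun r σ => deriv (fun s => u s σ) r) := by
  have h : (Function.uncurry fun r σ => deriv (fun s => u s σ) r)
      = fun q => fderiv ℝ (Function.uncurry u) q (1, 0) := by
    ext ⟨r, σ⟩
    have h1 : HasDerivAt (fun s : ℝ => (s, σ)) ((1 : ℝ), (0 : E)) r :=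
      (hasDerivAt_id' r).prodMk (hasDerivAt_const r σ)
    exact ((hu.differentiable (by simp) (r, σ)).hasFDerivAt.comp_hasDerivAt r h1).deriv
  rw [h]
  exact (hu.fderiv_right (by simp)).clm_apply contDiff_const

theorem deriv_eq_zero_of_notMem_Icc {f : ℝ → ℝ} {a b : ℝ} (hf : ∀ r, r ∉ Icc a b → f r = 0) (r : ℝ)
    (hr : r ∉ Icc a b) : deriv f r = 0 := by
  have : f =ᶠ[nhds r] fun _ => 0 :=
    Filter.eventually_of_mem (isClosed_Icc.isOpen_compl.mem_nhds hr) hf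
  rw [this.deriv_eq, deriv_const]

theorem setIntegral_Ioi_eq_intervalIntegral {g : ℝ → ℝ} {a b a' b' : ℝ} (ha' : 0 ≤ a')
    (ha : a' < a) (hab : a ≤ b) (hb : b ≤ b') (hg : ∀ r, r ∉ Icc a b → g r = 0) :
    ∫ r in Ioi (0 : ℝ), g r = ∫ r in a'..b', g r := by
  rw [intervalIntegral.integral_of_le (ha.le.trans (hab.trans hb))]
  refine setIntegral_eq_of_subset_of_forall_sdiff_eq_zero measurableSet_Ioi
    (fun r hr => ha'.trans_lt hr.1) fun r hr => hg r fun h => hr.2 ⟨ha.trans_le h.1, h.2.trans hb⟩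

theorem integrableOn_sphere_intervalIntegral {n : ℕ}
    {F : ℝ → EuclideanSpace ℝ (Fin (n + 1)) → ℝ}
    (hF : ContinuousOn (Function.uncurry F) (Ioi 0 ×ˢ univ)) {a b : ℝ} (ha : 0 < a) (hab : a ≤ b) :
    IntegrableOn (fun σ => ∫ r in a..b, F r σ) (Metric.sphere 0 1) μH[(n : ℝ)] := by
  have : Fact (Module.finrank ℝ (EuclideanSpace ℝ (Fin (n + 1))) = n + 1) := ⟨by simp⟩
  exact (continuous_intervalIntegral_of_continuousOn_Ioi hF ha hab).continuousOn
    |>.integrableOn_of_subset_isCompact (isCompact_sphere 0 1) Metric.isClosed_sphere.measurableSet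
      subset_rfl hausdorffMeasure_sphere_lt_top.ne

theorem hypInt_eq_setIntegral_intervalIntegral {n : ℕ}
    {F : ℝ → EuclideanSpace ℝ (Fin (n + 1)) → ℝ} {a b a' b' : ℝ} (ha' : 0 ≤ a')
    (ha : a' < a) (hab : a ≤ b) (hb : b ≤ b')
    (hF : ∀ σ ∈ Metric.sphere (0 : EuclideanSpace ℝ (Fin (n + 1))) 1, ∀ r, r ∉ Icc a b →
      F r σ = 0) :
    hypInt (n + 1) F = ∫ σ in Metric.sphere (0 : EuclideanSpace ℝ (Fin (n + 1))) 1,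
      (∫ r in a'..b', F r σ * sinh r ^ n) ∂μH[(n : ℝ)] := by
  have hd : ((n + 1 : ℕ) : ℝ) - 1 = n := by push_cast; ring
  rw [hypInt, hd, Nat.add_sub_cancel]
  refine setIntegral_congr_fun Metric.isClosed_sphere.measurableSet fun σ hσ => ?_
  exact setIntegral_Ioi_eq_intervalIntegral ha' ha hab hb fun r hr => by
    rw [hF σ hσ r hr, zero_mul]

theorem continuousOn_div_rpow_mul_sinh_pow {E : Type*} [TopologicalSpace E] {f : ℝ → E → ℝ}
    (hf : ContinuousOn (Function.uncurry f) (Ioi 0 ×ˢ univ)) (β : ℝ) (n : ℕ) :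
    ContinuousOn (Function.uncurry fun r σ => f r σ ^ 2 / r ^ β * sinh r ^ n)
      (Ioi 0 ×ˢ univ) := by
  have hr : ContinuousOn (fun q : ℝ × E => q.1 ^ β) (Ioi 0 ×ˢ univ) :=
    continuousOn_fst.rpow_const fun q hq => Or.inl (ne_of_gt hq.1)
  exact ((hf.pow 2).div hr fun q hq => (rpow_pos_of_pos hq.1 β).ne').mul
    ((continuous_sinh.comp continuous_fst).pow n).continuousOn

theorem setIntegral_linear_combination_le {X : Type*} [MeasurableSpace X] {μ : Measure X}
    {s : Set X} (hs : MeasurableSet s) {f₁ f₂ f₃ g : X → ℝ} {c₁ c₂ c₃ : ℝ}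
    (h₁ : IntegrableOn f₁ s μ) (h₂ : IntegrableOn f₂ s μ) (h₃ : IntegrableOn f₃ s μ)
    (hg : IntegrableOn g s μ) (h : ∀ x ∈ s, c₁ * f₁ x + c₂ * f₂ x + c₃ * f₃ x ≤ g x) :
    c₁ * (∫ x in s, f₁ x ∂μ) + c₂ * (∫ x in s, f₂ x ∂μ) + c₃ * (∫ x in s, f₃ x ∂μ)
      ≤ ∫ x in s, g x ∂μ := by
  have h₁₂ : IntegrableOn (fun x => c₁ * f₁ x + c₂ * f₂ x) s μ :=
    (h₁.const_mul c₁).add (h₂.const_mul c₂)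
  rw [← integral_const_mul, ← integral_const_mul, ← integral_const_mul,
    ← integral_add (h₁.const_mul c₁) (h₂.const_mul c₂), ← integral_add h₁₂ (h₃.const_mul c₃)]
  exact setIntegral_mono_on (h₁₂.add (h₃.const_mul c₃)) hg hs h

/-- Improved weighted Rellich inequality with three Hardy-type terms on `ℍ^N`,
for `0 ≤ 2α ≤ N-7`, with larger constants. -/
theorem weighted_radial_rellich_improved' (N : ℕ) (α : ℝ)
    (hα0 : 0 ≤ 2 * α) (hα : 2 * α ≤ (N : ℝ) - 7)
    (u : ℝ → EuclideanSpace ℝ (Fin N) → ℝ) (hu : IsCcAway N u) :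
    hypInt N (fun r σ => (radLap N u r σ) ^ 2 / r ^ α) ≥
      (((N : ℝ) + α) ^ 2 * ((N : ℝ) - 4 - α) ^ 2 / 16) *
          hypInt N (fun r σ => (u r σ) ^ 2 / r ^ (α + 4))
      + (((N : ℝ) - 1) * ((N : ℝ) - 2 - α) * ((N : ℝ) - 2 + α) / 4) *
          hypInt N (fun r σ => (u r σ) ^ 2 / r ^ (α + 2))
      + (((N : ℝ) - 1) ^ 2 / 4) * hypInt N (fun r σ => (u r σ) ^ 2 / r ^ α) := by
  obtain ⟨n, rfl⟩ : ∃ n, N = n + 1 := by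
    refine Nat.exists_eq_succ_of_ne_zero ?_
    rintro rfl
    norm_num at hα
    linarith
  obtain ⟨hsm, a, b, ha, hab, hsupp⟩ := hu
  have hsm' := contDiff_uncurry_deriv hsm
  have hsm'' := contDiff_uncurry_deriv hsm'
  have hz : ∀ σ ∈ Metric.sphere (0 : EuclideanSpace ℝ (Fin (n + 1))) 1, ∀ r, r ∉ Icc a b →
      u r σ = 0 := fun σ hσ r hr => hsupp r hr σ hσ
  have hz' : ∀ σ ∈ Metric.sphere (0 : EuclideanSpace ℝ (Fin (n + 1))) 1, ∀ r, r ∉ Icc a b →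
      deriv (fun s => u s σ) r = 0 := fun σ hσ => deriv_eq_zero_of_notMem_Icc (hz σ hσ)
  have hz'' : ∀ σ ∈ Metric.sphere (0 : EuclideanSpace ℝ (Fin (n + 1))) 1, ∀ r, r ∉ Icc a b →
      deriv (fun s => deriv (fun t => u t σ) s) r = 0 := fun σ hσ =>
    deriv_eq_zero_of_notMem_Icc (hz' σ hσ)
  have ha2 : 0 < a / 2 := half_pos ha
  have haa : a / 2 < a := half_lt_self ha
  have hbb : b ≤ b + 1 := by linarith
  have hab' : a / 2 ≤ b + 1 := haa.le.trans (hab.trans hbb)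
  have hn1 : ((n + 1 : ℕ) : ℝ) - 1 = n := by push_cast; ring
  have hLc : ContinuousOn (Function.uncurry (radLap (n + 1) u)) (Ioi 0 ×ˢ univ) := by
    have hcoth : ContinuousOn
        (fun q : ℝ × EuclideanSpace ℝ (Fin (n + 1)) => cosh q.1 / sinh q.1) (Ioi 0 ×ˢ univ) :=
      (continuous_cosh.comp continuous_fst).continuousOn.div
        (continuous_sinh.comp continuous_fst).continuousOn fun q hq => (sinh_pos_iff.2 hq.1).ne'
    exact hsm''.continuous.continuousOn.add
      ((continuousOn_const.mul hcoth).mul hsm'.continuous.continuousOn)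
  have huc := hsm.continuous.continuousOn (s := Ioi 0 ×ˢ univ)
  have hi (β : ℝ) := integrableOn_sphere_intervalIntegral
    (continuousOn_div_rpow_mul_sinh_pow huc β n) ha2 hab'
  have hiL := integrableOn_sphere_intervalIntegral
    (continuousOn_div_rpow_mul_sinh_pow hLc α n) ha2 hab'
  have hI (β : ℝ) := hypInt_eq_setIntegral_intervalIntegral (F := fun r σ => u r σ ^ 2 / r ^ β)
    ha2.le haa hab hbb fun σ hσ r hr => by simp [hz σ hσ r hr]
  have hIL := hypInt_eq_setIntegral_intervalIntegral
    (F := fun r σ => radLap (n + 1) u r σ ^ 2 / r ^ α)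
    ha2.le haa hab hbb fun σ hσ r hr => by simp [radLap, hz' σ hσ r hr, hz'' σ hσ r hr]
  rw [hI, hI, hI, hIL, ge_iff_le]
  refine setIntegral_linear_combination_le Metric.isClosed_sphere.measurableSet (hi _) (hi _)
    (hi _) hiL fun σ hσ => ?_
  have hline : ContDiff ℝ (⊤ : ℕ∞) fun r : ℝ => (r, σ) := contDiff_id.prodMk contDiff_const
  have hl : a / 2 ∉ Icc a b := fun h => haa.not_ge h.1
  have hr : b + 1 ∉ Icc a b := fun h => (lt_add_one b).not_ge h.2
  have key := rellich_interval (n := n) (α := α) (by linarith) (by push_cast at hα; linarith)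
    ha2 hab' (u := fun r => u r σ) (u' := fun r => deriv (fun s => u s σ) r)
    (u'' := fun r => deriv (fun s => deriv (fun t => u t σ) s) r)
    (fun x => ((hsm.comp hline).differentiable (by simp) x).hasDerivAt)
    (fun x => ((hsm'.comp hline).differentiable (by simp) x).hasDerivAt)
    (hsm''.comp hline).continuous
    (hz σ hσ _ hl) (hz σ hσ _ hr) (hz' σ hσ _ hl) (hz' σ hσ _ hr)
  simp only [radLap, hn1]
  convert key using 4 <;> push_cast <;> ring
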